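/- Let A, Q, P be n × n real matrices, let λ ∈ (0, 1), let θ ∈ ℕ with θ ≥ 1, and define h(X) = A X Aᵀ + Q. Let π : ℕ → ℝ be given by π(τ) = λ/(λθ + 1) for τ ≤ θ and π(τ) = (λ/(λθ + 1))·(1 − λ)^{τ − θ} for τ > θ. Suppose the matrix series S_{h^θ(P)} := Σ_{t=0}^{∞} (1 − λ)^t A^t h^θ(P) (Aᵀ)^t and S_Q := Σ_{t=0}^{∞} (1 − λ)^t A^t Q (Aᵀ)^t are summable. Then the series Σ_{τ=0}^{∞} π(τ)·Tr(h^τ(P)) is summable and equals (λ/(λθ + 1)) · [ Tr(S_{h^θ(P)}) + ((1 − λ)/λ)·Tr(S_Q) + Σ_{t=0}^{θ−1} Tr(h^t(P)) ]. -/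

import Mathlib

/-- Iterating the Lyapunov operator `t` times: a congruence term plus accumulated noise. -/
theorem lyapunov_iterate {m R : Type*} [Fintype m] [DecidableEq m] [CommRing R]
    (A Q X : Matrix m m R) (t : ℕ) :
    (fun Y : Matrix m m R => A * Y * A.transpose + Q)^[t] X =
      A ^ t * X * A.transpose ^ t + ∑ s ∈ Finset.range t, A ^ s * Q * A.transpose ^ s := by
  induction t with
  | zero => simp
  | succ t ih =>
    rw [Function.iterate_succ_apply', ih, Finset.sum_range_succ', mul_add, add_mul,
      Finset.mul_sum, Finset.sum_mul]
    simp only [pow_zero, one_mul, mul_one, add_assoc]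
    congr 1
    · rw [pow_succ', pow_succ]
      simp only [mul_assoc]
    · congr 1
      refine Finset.sum_congr rfl fun s _ => ?_
      rw [pow_succ' A, pow_succ A.transpose]
      simp only [mul_assoc]

theorem HasSum.trace {ι m R : Type*} [Fintype m] [AddCommMonoid R] [TopologicalSpace R]
    [ContinuousAdd R] {f : ι → Matrix m m R} {a : Matrix m m R} (hf : HasSum f a) :
    HasSum (fun i => (f i).trace) a.trace :=
  hf.map (Matrix.traceAddMonoidHom m R) continuous_id.matrix_trace

/-- Geometrically discounted partial sums. -/
theorem hasSum_pow_mul_sum_range {r : ℝ} (hr0 : 0 ≤ r) (hr1 : r < 1) {q : ℕ → ℝ} {S : ℝ}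
    (hq : HasSum (fun t => r ^ t * q t) S) :
    HasSum (fun t => r ^ t * ∑ s ∈ Finset.range t, q s) (r / (1 - r) * S) := by
  have hg : HasSum (fun t : ℕ => r ^ (t + 1)) (r / (1 - r)) := by
    simpa [pow_succ', div_eq_mul_inv] using (hasSum_geometric_of_lt_one hr0 hr1).mul_left r
  have hprod := summable_norm_sum_mul_antidiagonal_of_summable_norm hq.summable.norm
    hg.summable.norm
  have htsum := tsum_mul_tsum_eq_tsum_sum_antidiagonal_of_summable_norm hq.summable.norm
    hg.summable.norm
  rw [hq.tsum_eq, hg.tsum_eq] at htsum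
  rw [← hasSum_nat_add_iff' 1]
  have h := hprod.of_norm.hasSum
  rw [← htsum] at h
  simp only [Finset.range_one, Finset.sum_singleton, Finset.range_zero, Finset.sum_empty,
    mul_zero, sub_zero]
  rw [mul_comm]
  convert h using 2 with t
  rw [Finset.Nat.sum_antidiagonal_eq_sum_range_succ (fun i j => r ^ i * q i * r ^ (j + 1)),
    Finset.mul_sum]
  refine Finset.sum_congr rfl fun s hs => ?_
  have hst : t + 1 = s + (t - s + 1) := by
    have := Finset.mem_range.mp hs
    omega
  have hpow : r ^ (t + 1) = r ^ s * r ^ (t - s + 1) := by rw [← pow_add, ← hst]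
  rw [hpow]
  ring


open Matrix in
/-- The time-averaged estimation error under a threshold-`θ` policy (`θ ≥ 1`):
`Σ_τ π(τ) Tr(h^τ(P)) = (λ/(λθ+1)) [Tr(S_{h^θ(P)}) + ((1-λ)/λ) Tr(S_Q) + Σ_{t<θ} Tr(h^t(P))]`. -/
theorem averaged_error_threshold_pos {n : ℕ}
    (A Q P : Matrix (Fin n) (Fin n) ℝ) (lam : ℝ) (hlam : 0 < lam) (hlam1 : lam < 1)
    (θ : ℕ) (hθ : 1 ≤ θ) (π : ℕ → ℝ)
    (hπ : ∀ τ : ℕ, π τ = if τ ≤ θ then lam / (lam * θ + 1)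
      else lam / (lam * θ + 1) * (1 - lam) ^ (τ - θ))
    (hP : Summable (fun t : ℕ => (1 - lam) ^ t •
      (A ^ t * ((fun Y : Matrix (Fin n) (Fin n) ℝ => A * Y * Aᵀ + Q)^[θ] P) * Aᵀ ^ t)))
    (hQ : Summable (fun t : ℕ => (1 - lam) ^ t • (A ^ t * Q * Aᵀ ^ t))) :
    Summable (fun τ : ℕ =>
      π τ * ((fun Y : Matrix (Fin n) (Fin n) ℝ => A * Y * Aᵀ + Q)^[τ] P).trace) ∧
    ∑' τ : ℕ, π τ * ((fun Y : Matrix (Fin n) (Fin n) ℝ => A * Y * Aᵀ + Q)^[τ] P).trace =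
      lam / (lam * θ + 1) *
        ((∑' t : ℕ, (1 - lam) ^ t •
            (A ^ t * ((fun Y : Matrix (Fin n) (Fin n) ℝ => A * Y * Aᵀ + Q)^[θ] P) * Aᵀ ^ t)).trace +
          (1 - lam) / lam * (∑' t : ℕ, (1 - lam) ^ t • (A ^ t * Q * Aᵀ ^ t)).trace +
          ∑ t ∈ Finset.range θ,
            ((fun Y : Matrix (Fin n) (Fin n) ℝ => A * Y * Aᵀ + Q)^[t] P).trace) := by
  have hr0 : 0 ≤ 1 - lam := by linarith
  have hr1 : 1 - lam < 1 := by linarith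
  have hPt := hP.hasSum.trace
  have hQt := hQ.hasSum.trace
  simp only [trace_smul, smul_eq_mul] at hPt hQt
  have hB := hasSum_pow_mul_sum_range hr0 hr1 hQt
  rw [sub_sub_cancel] at hB
  have htail := (hPt.add hB).mul_left (lam / (lam * θ + 1))
  suffices h : HasSum (fun τ : ℕ =>
      π τ * ((fun Y : Matrix (Fin n) (Fin n) ℝ => A * Y * Aᵀ + Q)^[τ] P).trace) _ from
    ⟨h.summable, h.tsum_eq⟩
  rw [← hasSum_nat_add_iff' θ]
  have hshift : ∀ t : ℕ,
      π (t + θ) * ((fun Y : Matrix (Fin n) (Fin n) ℝ => A * Y * Aᵀ + Q)^[t + θ] P).trace =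
        lam / (lam * θ + 1) *
          ((1 - lam) ^ t *
              (A ^ t * ((fun Y : Matrix (Fin n) (Fin n) ℝ => A * Y * Aᵀ + Q)^[θ] P) *
                Aᵀ ^ t).trace +
            (1 - lam) ^ t * ∑ s ∈ Finset.range t, (A ^ s * Q * Aᵀ ^ s).trace) := by
    intro t
    have hπt : π (t + θ) = lam / (lam * θ + 1) * (1 - lam) ^ t := by
      rw [hπ]
      rcases Nat.eq_zero_or_pos t with rfl | ht
      · simp
      · rw [if_neg (by omega), Nat.add_sub_cancel]
    rw [hπt, Function.iterate_add_apply, lyapunov_iterate A Q _ t, trace_add, trace_sum,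
      mul_assoc, mul_add]
  have hhead : ∀ t ∈ Finset.range θ,
      π t * ((fun Y : Matrix (Fin n) (Fin n) ℝ => A * Y * Aᵀ + Q)^[t] P).trace =
        lam / (lam * θ + 1) *
          ((fun Y : Matrix (Fin n) (Fin n) ℝ => A * Y * Aᵀ + Q)^[t] P).trace := by
    intro t ht
    rw [hπ, if_pos (Finset.mem_range.mp ht).le]
  rw [funext hshift, Finset.sum_congr rfl hhead, ← Finset.mul_sum, ← mul_sub,
    add_sub_cancel_right]
  exact htail
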